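/- Let μ > 0, T > 0 and ε > 0. For all p = (p₁,p₂) and q = (q₁,q₂) in ℝ² with p₁, p₂, q₁, q₂ ≥ 0, |q| ≤ ε and |p|² ≥ (√μ + ε)² + T, one has B_T(p,q) ≥ tanh(1/2) / (2(|p|² + |q|² − μ)). (Note that under these hypotheses |p|² + |q|² − μ ≥ T > 0, so the right-hand side is well defined and positive.) -/

import Mathlib

open MeasureTheory Real

/-- The function `B_T(p,q)` on `ℝ² × ℝ²`, set to `0` on the measure-zero set
`|p|² + |q|² = μ` where the defining expression is singular. -/
noncomputable def BT (T μ : ℝ) (p q : ℝ × ℝ) : ℝ :=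
  if p.1 ^ 2 + p.2 ^ 2 + q.1 ^ 2 + q.2 ^ 2 = μ then 0
  else
    (Real.tanh (((p.1 + q.1) ^ 2 + (p.2 + q.2) ^ 2 - μ) / (2 * T)) +
        Real.tanh (((p.1 - q.1) ^ 2 + (p.2 - q.2) ^ 2 - μ) / (2 * T))) /
      (2 * (p.1 ^ 2 + p.2 ^ 2 + q.1 ^ 2 + q.2 ^ 2 - μ))

theorem Real.monotone_tanh : Monotone Real.tanh := fun x y h => by
  rwa [← Real.artanh_le_artanh_iff ⟨Real.neg_one_lt_tanh x, Real.tanh_lt_one x⟩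
    ⟨Real.neg_one_lt_tanh y, Real.tanh_lt_one y⟩, Real.artanh_tanh, Real.artanh_tanh]

theorem sq_le_sq_sub_add_sq_sub {a b c d s : ℝ} (hs : 0 ≤ s)
    (h : s + √(c ^ 2 + d ^ 2) ≤ √(a ^ 2 + b ^ 2)) :
    s ^ 2 ≤ (a - c) ^ 2 + (b - d) ^ 2 := by
  have hP := Real.sq_sqrt (show 0 ≤ a ^ 2 + b ^ 2 by positivity)
  have hQ := Real.sq_sqrt (show 0 ≤ c ^ 2 + d ^ 2 by positivity)
  have hPQ : a * c + b * d ≤ √(a ^ 2 + b ^ 2) * √(c ^ 2 + d ^ 2) := by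
    refine abs_le_of_sq_le_sq' ?_ (by positivity) |>.2
    rw [mul_pow, hP, hQ]
    nlinarith [sq_nonneg (a * d - b * c)]
  nlinarith [pow_le_pow_left₀ hs (le_sub_iff_add_le.2 h) 2]

/-- Pointwise lower bound for `B_T` in the regime `p₁,p₂,q₁,q₂ ≥ 0`, `|q| ≤ ε`,
`|p|² ≥ (√μ + ε)² + T`: `B_T(p,q) ≥ tanh(1/2) / (2(|p|² + |q|² − μ))`. -/
theorem BT_pointwise_lower_bound (μ T ε : ℝ) (hμ : 0 < μ) (hT : 0 < T) (hε : 0 < ε)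
    (p q : ℝ × ℝ) (hp1 : 0 ≤ p.1) (hp2 : 0 ≤ p.2) (hq1 : 0 ≤ q.1) (hq2 : 0 ≤ q.2)
    (hq : Real.sqrt (q.1 ^ 2 + q.2 ^ 2) ≤ ε)
    (hp : (Real.sqrt μ + ε) ^ 2 + T ≤ p.1 ^ 2 + p.2 ^ 2) :
    Real.tanh (1 / 2) / (2 * (p.1 ^ 2 + p.2 ^ 2 + q.1 ^ 2 + q.2 ^ 2 - μ)) ≤
      BT T μ p q := by
  have hs := Real.sq_sqrt hμ.le
  have hs0 := Real.sqrt_nonneg μ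
  have hμε : μ + T ≤ p.1 ^ 2 + p.2 ^ 2 := by nlinarith
  have hden : 0 < p.1 ^ 2 + p.2 ^ 2 + q.1 ^ 2 + q.2 ^ 2 - μ := by
    nlinarith [sq_nonneg q.1, sq_nonneg q.2]
  have hplus : 1 / 2 ≤ ((p.1 + q.1) ^ 2 + (p.2 + q.2) ^ 2 - μ) / (2 * T) := by
    rw [div_le_div_iff₀ two_pos (by positivity)]
    nlinarith [mul_nonneg hp1 hq1, mul_nonneg hp2 hq2, sq_nonneg q.1, sq_nonneg q.2]
  have hminus : 0 ≤ ((p.1 - q.1) ^ 2 + (p.2 - q.2) ^ 2 - μ) / (2 * T) := by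
    have hP : √μ + ε ≤ √(p.1 ^ 2 + p.2 ^ 2) := Real.le_sqrt_of_sq_le (by linarith)
    have := sq_le_sq_sub_add_sq_sub hs0 (show √μ + √(q.1 ^ 2 + q.2 ^ 2) ≤ _ by linarith)
    exact div_nonneg (by linarith) (by positivity)
  have h1 := Real.monotone_tanh hplus
  have h2 := Real.monotone_tanh hminus
  rw [Real.tanh_zero] at h2
  rw [BT, if_neg (fun h => by linarith)]
  gcongr
  linarith
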